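/- Let μ(ξ) be the lowest eigenvalue of the Neumann realization on L²(ℝ₊) of −d²/dt² + (t+ξ)², with normalized positive ground state u_ξ. Define M_k = ∫_{t>0} (t+ξ₀)^k u_{ξ₀}(t)² dt where ξ₀ is the unique minimum point of μ, Θ₀ = μ(ξ₀), and C₁ = u_{ξ₀}(0)²/3. Then M₀ = 1, M₁ = 0, M₂ = Θ₀/2, and M₃ = C₁/2. -/

import Mathlib

open MeasureTheory Set Filter Topology Polynomial

theorem monotoneOn_Ici_of_hasDerivAt_nonneg {f f' : ℝ → ℝ} {a : ℝ}
    (hf : ∀ t, a ≤ t → HasDerivAt f (f' t) t) (hf' : ∀ t, a ≤ t → 0 ≤ f' t) :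
    MonotoneOn f (Ici a) := by
  refine monotoneOn_of_hasDerivWithinAt_nonneg (f' := f') (convex_Ici a)
    (fun t ht => (hf t ht).continuousAt.continuousWithinAt) ?_ ?_
  · intro t ht
    exact (hf t (interior_subset ht)).hasDerivWithinAt
  · intro t ht
    exact hf' t (interior_subset ht)

/-- If `u'' = V u` and `w'' = W w` on the half-line with Neumann conditions at `0`, and `u`, `w` are
positive there, then `∫ (V - W) u² ≤ 0`: the Picone identity, with the boundary term at infinity
controlled through the Riccati inequality it satisfies. -/
theorem integral_potential_sub_mul_sq_nonpos {u u' w w' V W : ℝ → ℝ}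
    (hV : Continuous V) (hW : Continuous W) (hc : Continuous u)
    (hu : ∀ t, HasDerivAt u (u' t) t) (hw : ∀ t, HasDerivAt w (w' t) t)
    (hu' : ∀ t, 0 ≤ t → HasDerivAt u' (V t * u t) t)
    (hw' : ∀ t, 0 ≤ t → HasDerivAt w' (W t * w t) t)
    (hu0 : u' 0 = 0) (hw0 : w' 0 = 0)
    (hupos : ∀ t, 0 ≤ t → 0 < u t) (hwpos : ∀ t, 0 ≤ t → 0 < w t)
    (hint : IntegrableOn (fun t => u t ^ 2) (Ioi 0))
    (hint' : IntegrableOn (fun t => (V t - W t) * u t ^ 2) (Ioi 0)) :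
    ∫ t in Ioi (0 : ℝ), (V t - W t) * u t ^ 2 ≤ 0 := by
  by_contra! hpos
  set c := ∫ t in Ioi (0 : ℝ), (V t - W t) * u t ^ 2
  have hg : Continuous fun t => (V t - W t) * u t ^ 2 := by fun_prop
  have hu2 : Continuous fun t => u t ^ 2 := by fun_prop
  set I : ℝ → ℝ := fun t => ∫ x in (0 : ℝ)..t, (V x - W x) * u x ^ 2 with hI
  set N : ℝ → ℝ := fun t => ∫ x in (0 : ℝ)..t, u x ^ 2 with hN
  have hId : ∀ t, HasDerivAt I ((V t - W t) * u t ^ 2) t := fun t =>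
    (hg.integral_hasStrictDerivAt 0 t).hasDerivAt
  have hNd : ∀ t, HasDerivAt N (u t ^ 2) t := fun t =>
    (hu2.integral_hasStrictDerivAt 0 t).hasDerivAt
  have hIlim : Tendsto I atTop (𝓝 c) :=
    intervalIntegral_tendsto_integral_Ioi 0 hint' tendsto_id
  have hNlim : Tendsto N atTop (𝓝 (∫ t in Ioi (0 : ℝ), u t ^ 2)) :=
    intervalIntegral_tendsto_integral_Ioi 0 hint tendsto_id
  set k : ℝ → ℝ := fun t => u t * u' t - u t ^ 2 * w' t / w t - I t with hk
  have hkd : ∀ t, 0 ≤ t → HasDerivAt k ((k t + I t) ^ 2 / u t ^ 2) t := by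
    intro t ht
    have hut := (hupos t ht).ne'
    have hwt := (hwpos t ht).ne'
    have := (((hu t).mul (hu' t ht)).sub
      ((((hu t).pow 2).mul (hw' t ht)).div (hw t) hwt)).sub (hId t)
    refine this.congr_deriv ?_
    simp only [hk, Pi.pow_apply, Pi.mul_apply]
    field_simp
    ring
  have hk0 : k 0 = 0 := by simp [hk, hI, hu0, hw0]
  have hkmono : MonotoneOn k (Ici 0) :=
    monotoneOn_Ici_of_hasDerivAt_nonneg hkd fun t _ => by positivity
  have hknn : ∀ t, 0 ≤ t → 0 ≤ k t := fun t ht => by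
    simpa [hk0] using hkmono (mem_Ici.2 le_rfl) (mem_Ici.2 ht) ht
  obtain ⟨R₀, hR₀⟩ := eventually_atTop.1 (hIlim.eventually (lt_mem_nhds (half_lt_self hpos)))
  set R := max R₀ 0
  have hR : ∀ t, R ≤ t → 0 ≤ t ∧ c / 2 < I t := fun t ht =>
    ⟨(le_max_right _ _).trans ht, hR₀ t ((le_max_left _ _).trans ht)⟩
  set m : ℝ → ℝ := fun t => -(k t + c / 2)⁻¹ - 2 * t + N t with hm
  have hmmono : MonotoneOn m (Ici R) := by
    refine monotoneOn_Ici_of_hasDerivAt_nonneg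
      (f' := fun t => (k t + I t) ^ 2 / u t ^ 2 / (k t + c / 2) ^ 2 - 2 + u t ^ 2) ?_ ?_
    · intro t ht
      have h1 := hknn t (hR t ht).1
      have h2 : k t + c / 2 ≠ 0 := by positivity
      have := (((((hkd t (hR t ht).1).add_const (c / 2)).inv h2).neg).sub
        ((hasDerivAt_id t).const_mul 2)).add (hNd t)
      refine this.congr_deriv ?_
      ring
    · intro t ht
      obtain ⟨h0, h1⟩ := hR t ht
      have h2 := hknn t h0
      have h3 : 0 < k t + c / 2 := by positivity
      have h4 : 0 < u t ^ 2 := pow_pos (hupos t h0) 2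
      have h5 : 1 / u t ^ 2 ≤ (k t + I t) ^ 2 / u t ^ 2 / (k t + c / 2) ^ 2 := by
        rw [div_right_comm]
        gcongr
        rw [one_le_div (by positivity)]
        gcongr
      have h6 : 2 - u t ^ 2 ≤ 1 / u t ^ 2 := by
        rw [le_div_iff₀ h4]
        nlinarith [sq_nonneg (u t ^ 2 - 1)]
      linarith
  have hbot : Tendsto (fun t => -2 * t + N t) atTop atBot :=
    ((tendsto_const_mul_atBot_of_neg (by norm_num)).2 tendsto_id).atBot_add hNlim
  obtain ⟨t, h1, h2⟩ :=
    ((hbot.eventually (eventually_lt_atBot (m R))).and (eventually_ge_atTop R)).exists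
  have h3 := hmmono (mem_Ici.2 le_rfl) (mem_Ici.2 h2) h2
  have h4 := hknn t (hR t h2).1
  have h5 : 0 ≤ (k t + c / 2)⁻¹ := by positivity
  simp only [hm] at h1 h3
  linarith

section Decay

variable {u u' : ℝ → ℝ} {T : ℝ}

/-- A positive function, convex near infinity and square integrable, decreases near infinity. -/
theorem deriv_nonpos_of_convex_of_integrableOn_sq
    (hu : ∀ t, HasDerivAt u (u' t) t) (hmono : MonotoneOn u' (Ici T)) (hT : 0 ≤ T)
    (hpos : ∀ t, 0 ≤ t → 0 < u t) (hint : IntegrableOn (fun t => u t ^ 2) (Ioi 0)) :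
    ∀ t, T ≤ t → u' t ≤ 0 := by
  intro a ha
  by_contra! hlt
  have hinc : MonotoneOn u (Ici a) := monotoneOn_Ici_of_hasDerivAt_nonneg (fun t _ => hu t)
    fun t ht => hlt.le.trans (hmono (mem_Ici.2 ha) (mem_Ici.2 (ha.trans ht)) ht)
  have hua := hpos a (hT.trans ha)
  have hconst : IntegrableOn (fun _ : ℝ => u a ^ 2) (Ioi a) := by
    refine (hint.mono_set (Ioi_subset_Ioi (hT.trans ha))).mono' (by fun_prop) ?_
    filter_upwards [ae_restrict_mem measurableSet_Ioi] with t ht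
    rw [Real.norm_of_nonneg (by positivity)]
    gcongr
    exact hinc (mem_Ici.2 le_rfl) (mem_Ici.2 (le_of_lt ht)) (le_of_lt ht)
  rw [integrableOn_const_iff] at hconst
  rcases hconst with h | h
  · simp [hua.ne'] at h
  · simp at h

/-- Integrability of `t ^ (k + 1) u²` gives pointwise decay of `t ^ k u²` for decreasing `u`. -/
theorem tendsto_pow_mul_sq_of_antitoneOn (hT : 0 ≤ T) (hanti : AntitoneOn u (Ici T))
    (hpos : ∀ t, 0 ≤ t → 0 < u t) (k : ℕ)
    (hint : IntegrableOn (fun t => t ^ (k + 1) * u t ^ 2) (Ioi 0)) :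
    Tendsto (fun t => t ^ k * u t ^ 2) atTop (𝓝 0) := by
  set C := ∫ t in Ioi (0 : ℝ), t ^ (k + 1) * u t ^ 2
  have hlim : Tendsto (fun t : ℝ => 2 ^ (k + 1) * C / t) atTop (𝓝 0) :=
    tendsto_const_nhds.div_atTop tendsto_id
  refine squeeze_zero' ?_ ?_ hlim
  · filter_upwards [eventually_ge_atTop 0] with t ht
    positivity
  filter_upwards [eventually_ge_atTop (T + 2)] with t ht
  have ht0 : 0 < t := by linarith
  have hsub : Ioc (t - 1) t ⊆ Ioi 0 := fun x hx => by
    have := hx.1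
    simp only [mem_Ioi]
    linarith
  have h1 : ∫ _ in Ioc (t - 1) t, (t - 1) ^ (k + 1) * u t ^ 2 ≤
      ∫ x in Ioc (t - 1) t, x ^ (k + 1) * u x ^ 2 := by
    refine setIntegral_mono_on (integrableOn_const (by simp)) (hint.mono_set hsub)
      measurableSet_Ioc ?_
    intro x hx
    have hx1 : 0 ≤ t - 1 := by linarith
    have hut := hpos t ht0.le
    have := hanti (mem_Ici.2 (by linarith [hx.1])) (mem_Ici.2 (by linarith)) hx.2
    have hx2 := hx.1
    have hx3 : 0 ≤ x := by linarith
    gcongr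
  have h2 : ∫ x in Ioc (t - 1) t, x ^ (k + 1) * u x ^ 2 ≤ C := by
    refine setIntegral_mono_set hint ?_ hsub.eventuallyLE
    filter_upwards [ae_restrict_mem measurableSet_Ioi] with x hx
    have : 0 < x := hx
    show 0 ≤ _
    positivity
  have h3 : (t - 1) ^ (k + 1) * u t ^ 2 ≤ C := by
    simpa using h1.trans h2
  have h4 : (t / 2) ^ (k + 1) * u t ^ 2 ≤ C := by
    refine le_trans ?_ h3
    gcongr
    linarith
  rw [le_div_iff₀ ht0]
  calc t ^ k * u t ^ 2 * t = 2 ^ (k + 1) * ((t / 2) ^ (k + 1) * u t ^ 2) := by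
        rw [div_pow]; field_simp; ring
    _ ≤ 2 ^ (k + 1) * C := by gcongr

/-- Near infinity the derivative of a positive decreasing convex function is dominated by an
earlier value of the function. -/
theorem tendsto_pow_mul_deriv_sq (hu : ∀ t, HasDerivAt u (u' t) t)
    (hmono : MonotoneOn u' (Ici T)) (hT : 0 ≤ T) (hnonpos : ∀ t, T ≤ t → u' t ≤ 0)
    (hpos : ∀ t, 0 ≤ t → 0 < u t) (k : ℕ)
    (hlim : Tendsto (fun t => t ^ k * u t ^ 2) atTop (𝓝 0)) :
    Tendsto (fun t => t ^ k * u' t ^ 2) atTop (𝓝 0) := by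
  have hlim' : Tendsto (fun t : ℝ => 2 ^ k * ((t - 1) ^ k * u (t - 1) ^ 2)) atTop (𝓝 0) := by
    simpa [sub_eq_add_neg] using (hlim.comp
      (tendsto_atTop_add_const_right atTop (-1 : ℝ) tendsto_id)).const_mul
      ((2 : ℝ) ^ k)
  refine squeeze_zero' ?_ ?_ hlim'
  · filter_upwards [eventually_ge_atTop 0] with t ht
    positivity
  filter_upwards [eventually_ge_atTop (T + 2)] with t ht
  obtain ⟨c, hc, hslope⟩ := exists_hasDerivAt_eq_slope u u' (show t - 1 < t by linarith)
    (fun x _ => (hu x).continuousAt.continuousWithinAt) fun x _ => hu x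
  have h1 : u' c ≤ u' t :=
    hmono (mem_Ici.2 (by linarith [hc.1])) (mem_Ici.2 (by linarith)) hc.2.le
  have h2 : u' t ≤ 0 := hnonpos t (by linarith)
  have h3 : 0 < u t := hpos t (by linarith)
  have h4 : u' c = u t - u (t - 1) := by simpa using hslope
  have h5 : u' t ^ 2 ≤ u (t - 1) ^ 2 := sq_le_sq' (by linarith) (by linarith)
  rw [← mul_assoc, ← mul_pow]
  have h6 : t ≤ 2 * (t - 1) := by linarith
  have h7 : 0 ≤ t := by linarith
  have h8 : 0 ≤ (2 * (t - 1)) ^ k := pow_nonneg (h7.trans h6) k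
  gcongr

theorem tendsto_eval_mul {f : ℝ → ℝ}
    (hf : ∀ k : ℕ, Tendsto (fun t => t ^ k * f t) atTop (𝓝 0)) (p : ℝ[X]) :
    Tendsto (fun t => p.eval t * f t) atTop (𝓝 0) := by
  induction p using Polynomial.induction_on' with
  | add p q hp hq => simpa [add_mul] using hp.add hq
  | monomial n a => simpa [mul_assoc] using (hf n).const_mul a

theorem integrableOn_eval_mul {f : ℝ → ℝ} {s : Set ℝ}
    (hf : ∀ k : ℕ, IntegrableOn (fun t => t ^ k * f t) s) (p : ℝ[X]) :
    IntegrableOn (fun t => p.eval t * f t) s := by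
  induction p using Polynomial.induction_on' with
  | add p q hp hq => simpa [add_mul, IntegrableOn] using! Integrable.add hp hq
  | monomial n a => simpa [mul_assoc, IntegrableOn] using (hf n).const_mul a

end Decay

/-- Virial identity for a positive Neumann solution of `u'' = V u` with a polynomial potential and
finite moments. -/
theorem integral_virial {u u' : ℝ → ℝ} {V : ℝ[X]} {T : ℝ}
    (hu : ∀ t, HasDerivAt u (u' t) t)
    (hu' : ∀ t, 0 ≤ t → HasDerivAt u' (V.eval t * u t) t) (hu0 : u' 0 = 0)
    (hpos : ∀ t, 0 ≤ t → 0 < u t) (hT : 0 ≤ T) (hV : ∀ t, T ≤ t → 0 ≤ V.eval t)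
    (hint : ∀ k : ℕ, IntegrableOn (fun t => t ^ k * u t ^ 2) (Ioi 0)) (p : ℝ[X]) :
    ∫ t in Ioi (0 : ℝ),
        (C (1 / 2) * derivative (derivative (derivative p)) - 2 * derivative p * V
          - p * derivative V).eval t * u t ^ 2 =
      (p.eval 0 * V.eval 0 - (derivative (derivative p)).eval 0 / 2) * u 0 ^ 2 := by
  have hmono : MonotoneOn u' (Ici T) :=
    monotoneOn_Ici_of_hasDerivAt_nonneg (fun t ht => hu' t (hT.trans ht))
      fun t ht => mul_nonneg (hV t ht) (hpos t (hT.trans ht)).le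
  have hnonpos := deriv_nonpos_of_convex_of_integrableOn_sq hu hmono hT hpos
    (by simpa using hint 0)
  have hanti : AntitoneOn u (Ici T) := by
    have := monotoneOn_Ici_of_hasDerivAt_nonneg (f := fun t => -u t) (fun t _ => (hu t).neg)
      fun t ht => neg_nonneg.2 (hnonpos t ht)
    simpa using this.neg
  have hlim (k : ℕ) := tendsto_pow_mul_sq_of_antitoneOn hT hanti hpos k (hint (k + 1))
  have hlim' (k : ℕ) := tendsto_pow_mul_deriv_sq hu hmono hT hnonpos hpos k (hlim k)
  have hlim'' : ∀ k : ℕ, Tendsto (fun t => t ^ k * (u t * u' t)) atTop (𝓝 0) := by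
    intro k
    have hsum : Tendsto (fun t => t ^ k * u t ^ 2 + t ^ k * u' t ^ 2) atTop (𝓝 0) := by
      simpa using (hlim k).add (hlim' k)
    refine squeeze_zero_norm' ?_ hsum
    filter_upwards [eventually_ge_atTop 0] with t ht
    rw [norm_mul, Real.norm_of_nonneg (by positivity), ← mul_add]
    gcongr
    rw [Real.norm_eq_abs, abs_le]
    constructor <;> nlinarith [sq_nonneg (u t + u' t), sq_nonneg (u t - u' t)]
  set G : ℝ → ℝ := fun t => p.eval t * u' t ^ 2 - (p * V).eval t * u t ^ 2
    - (derivative p).eval t * (u t * u' t)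
    + (C (1 / 2) * derivative (derivative p)).eval t * u t ^ 2 with hG
  have hGlim : Tendsto G atTop (𝓝 0) := by
    simpa only [sub_zero, add_zero] using (((tendsto_eval_mul hlim' p).sub
      (tendsto_eval_mul hlim (p * V))).sub
      (tendsto_eval_mul hlim'' (derivative p))).add
      (tendsto_eval_mul hlim (C (1 / 2) * derivative (derivative p)))
  have hGd : ∀ t ∈ Ici (0 : ℝ), HasDerivAt G
      ((C (1 / 2) * derivative (derivative (derivative p)) - 2 * derivative p * V
          - p * derivative V).eval t * u t ^ 2) t := by
    intro t ht
    have := ((((p.hasDerivAt t).mul ((hu' t ht).pow 2)).sub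
      (((p * V).hasDerivAt t).mul ((hu t).pow 2))).sub
      (((derivative p).hasDerivAt t).mul ((hu t).mul (hu' t ht)))).add
      (((C (1 / 2) * derivative (derivative p)).hasDerivAt t).mul ((hu t).pow 2))
    refine this.congr_deriv ?_
    simp
    ring
  rw [integral_Ioi_of_hasDerivAt_of_tendsto' hGd (integrableOn_eval_mul hint _) hGlim]
  simp [hG, hu0]
  ring

/-- Moment identities of Bernoff–Sternberg for the de Gennes ground state:
`M₀ = 1`, `M₁ = 0`, `M₂ = Θ₀/2`, `M₃ = C₁/2`. -/
theorem deGennes_moments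
    (μ : ℝ → ℝ) (u : ℝ → ℝ → ℝ) (ξ₀ : ℝ)
    -- `u ξ` is a smooth Neumann eigenfunction of `-d²/dt² + (t+ξ)²` with eigenvalue `μ ξ`
    (hsmooth : ∀ ξ, ContDiff ℝ (⊤ : ℕ∞) (u ξ))
    (heig : ∀ ξ t, 0 ≤ t →
      - deriv (deriv (u ξ)) t + (t + ξ)^2 * u ξ t = μ ξ * u ξ t)
    (hneum : ∀ ξ, deriv (u ξ) 0 = 0)
    (hpos : ∀ ξ t, 0 ≤ t → 0 < u ξ t)
    (hnorm : ∀ ξ, ∫ t in Ioi (0:ℝ), (u ξ t)^2 = 1)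
    (hdecay : ∀ ξ, ∀ k : ℕ,
      Integrable (fun t => t^k * (u ξ t)^2) (volume.restrict (Ioi (0:ℝ))))
    -- `μ ξ` is the lowest such eigenvalue
    (hlowest : ∀ ξ E (v : ℝ → ℝ), ContDiff ℝ (⊤ : ℕ∞) v →
      (∀ t, 0 ≤ t → - deriv (deriv v) t + (t + ξ)^2 * v t = E * v t) →
      deriv v 0 = 0 → (∫ t in Ioi (0:ℝ), (v t)^2) = 1 →
      Integrable (fun t => t^2 * (v t)^2) (volume.restrict (Ioi (0:ℝ))) →
      μ ξ ≤ E)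
    -- `ξ₀` is the minimum point of `μ`
    (hmin : ∀ ξ, μ ξ₀ ≤ μ ξ) :
    (∫ t in Ioi (0:ℝ), (t + ξ₀)^0 * (u ξ₀ t)^2) = 1
    ∧ (∫ t in Ioi (0:ℝ), (t + ξ₀)^1 * (u ξ₀ t)^2) = 0
    ∧ (∫ t in Ioi (0:ℝ), (t + ξ₀)^2 * (u ξ₀ t)^2) = μ ξ₀ / 2
    ∧ (∫ t in Ioi (0:ℝ), (t + ξ₀)^3 * (u ξ₀ t)^2) = ((u ξ₀ 0)^2 / 3) / 2 := by
  have hu : ∀ ξ t, HasDerivAt (u ξ) (deriv (u ξ) t) t := fun ξ t =>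
    ((hsmooth ξ).differentiable (by simp)).differentiableAt.hasDerivAt
  have hdd : ∀ ξ, Differentiable ℝ (deriv (u ξ)) := fun ξ =>
    ((contDiff_infty_iff_deriv.1 (hsmooth ξ)).2).differentiable (by simp)
  have hu' : ∀ ξ t, 0 ≤ t →
      HasDerivAt (deriv (u ξ)) (((X + C ξ) ^ 2 - C (μ ξ)).eval t * u ξ t) t := by
    intro ξ t ht
    refine (hdd ξ t).hasDerivAt.congr_deriv ?_
    simp only [eval_sub, eval_pow, eval_add, eval_X, eval_C]
    linarith [heig ξ t ht]
  have hint (p : ℝ[X]) : IntegrableOn (fun t => p.eval t * u ξ₀ t ^ 2) (Ioi 0) :=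
    integrableOn_eval_mul (hdecay ξ₀) p
  set M : ℕ → ℝ := fun k => ∫ t in Ioi (0 : ℝ), (t + ξ₀) ^ k * u ξ₀ t ^ 2 with hM
  have hMint (k : ℕ) : IntegrableOn (fun t => (t + ξ₀) ^ k * u ξ₀ t ^ 2) (Ioi 0) :=
    (hint ((X + C ξ₀) ^ k)).congr_fun (fun t _ => by simp) measurableSet_Ioi
  have hM0 : M 0 = 1 := by simpa [hM] using hnorm ξ₀
  have hcomb (k : ℕ) (a b : ℝ) :
      ∫ t in Ioi (0 : ℝ), (a * (t + ξ₀) ^ k + b) * u ξ₀ t ^ 2 = a * M k + b := by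
    have h := integral_add ((hMint k).const_mul a) ((hMint 0).const_mul b)
    rw [integral_const_mul, integral_const_mul] at h
    change _ = a * M k + b * M 0 at h
    rw [hM0, mul_one] at h
    rw [← h]
    refine integral_congr_ae (.of_forall fun t => ?_)
    simp only
    ring
  have hvar : ∀ ξ, 2 * (ξ₀ - ξ) * M 1 - (ξ₀ - ξ) ^ 2 + (μ ξ - μ ξ₀) ≤ 0 := by
    intro ξ
    have hfun (t : ℝ) : ((X + C ξ₀) ^ 2 - C (μ ξ₀)).eval t - ((X + C ξ) ^ 2 - C (μ ξ)).eval t =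
        2 * (ξ₀ - ξ) * (t + ξ₀) ^ 1 + (μ ξ - μ ξ₀ - (ξ₀ - ξ) ^ 2) := by
      simp
      ring
    have h := integral_potential_sub_mul_sq_nonpos (Polynomial.continuous _)
      (Polynomial.continuous _) (hsmooth ξ₀).continuous (hu ξ₀) (hu ξ) (hu' ξ₀) (hu' ξ) (hneum ξ₀)
      (hneum ξ) (hpos ξ₀) (hpos ξ) (by simpa using hint 1)
      ((hint (((X + C ξ₀) ^ 2 - C (μ ξ₀)) - ((X + C ξ) ^ 2 - C (μ ξ)))).congr_fun
        (fun t _ => by simp only [eval_sub]) measurableSet_Ioi)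
    simp only [hfun, hcomb] at h
    linarith
  have hM1 : M 1 = 0 := by
    have h := hvar (ξ₀ - M 1)
    have := hmin (ξ₀ - M 1)
    nlinarith [sq_nonneg (M 1)]
  have hV (t : ℝ) (ht : |ξ₀| + |μ ξ₀| + 1 ≤ t) : 0 ≤ ((X + C ξ₀) ^ 2 - C (μ ξ₀)).eval t := by
    simp only [eval_sub, eval_pow, eval_add, eval_X, eval_C]
    have h1 : |μ ξ₀| + 1 ≤ t + ξ₀ := by linarith [neg_abs_le ξ₀]
    nlinarith [le_abs_self (μ ξ₀), abs_nonneg (μ ξ₀)]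
  have hvir := integral_virial (hu ξ₀) (hu' ξ₀) (hneum ξ₀) (hpos ξ₀) (by positivity) hV
    (hdecay ξ₀)
  have hξ : ξ₀ ^ 2 = μ ξ₀ := by
    have h := hvir 1
    have hfun (t : ℝ) : (C (1 / 2) * derivative (derivative (derivative 1))
        - 2 * derivative 1 * ((X + C ξ₀) ^ 2 - C (μ ξ₀))
        - 1 * derivative ((X + C ξ₀) ^ 2 - C (μ ξ₀))).eval t = -2 * (t + ξ₀) ^ 1 + 0 := by
      simp [derivative_pow]
    simp only [hfun, hcomb, hM1] at h
    have h0 := (hpos ξ₀ 0 le_rfl).ne'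
    simp [h0] at h
    linarith
  have hM2 : M 2 = μ ξ₀ / 2 := by
    have h := hvir (X + C ξ₀)
    have hfun (t : ℝ) : (C (1 / 2) * derivative (derivative (derivative (X + C ξ₀)))
        - 2 * derivative (X + C ξ₀) * ((X + C ξ₀) ^ 2 - C (μ ξ₀))
        - (X + C ξ₀) * derivative ((X + C ξ₀) ^ 2 - C (μ ξ₀))).eval t =
        -4 * (t + ξ₀) ^ 2 + 2 * μ ξ₀ := by
      simp [derivative_pow]
      ring
    simp only [hfun, hcomb] at h
    simp [hξ] at h
    linarith
  have hM3 : M 3 = (u ξ₀ 0 ^ 2 / 3) / 2 := by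
    have h := hvir ((X + C ξ₀) ^ 2)
    have hfun (t : ℝ) : (C (1 / 2) * derivative (derivative (derivative ((X + C ξ₀) ^ 2)))
        - 2 * derivative ((X + C ξ₀) ^ 2) * ((X + C ξ₀) ^ 2 - C (μ ξ₀))
        - (X + C ξ₀) ^ 2 * derivative ((X + C ξ₀) ^ 2 - C (μ ξ₀))).eval t * u ξ₀ t ^ 2 =
        (-6 * (t + ξ₀) ^ 3 + 0) * u ξ₀ t ^ 2
          + (4 * μ ξ₀ * (t + ξ₀) ^ 1 + 0) * u ξ₀ t ^ 2 := by
      simp [derivative_pow]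
      ring
    have hint' (k : ℕ) (a : ℝ) :
        IntegrableOn (fun t => (a * (t + ξ₀) ^ k + 0) * u ξ₀ t ^ 2) (Ioi 0) := by
      simpa [IntegrableOn, mul_assoc] using (hMint k).const_mul a
    simp only [hfun] at h
    rw [integral_add (hint' 3 _) (hint' 1 _), hcomb, hcomb, hM1] at h
    simp [hξ, derivative_pow] at h
    linarith
  exact ⟨hM0, hM1, hM2, hM3⟩
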